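/- Let Δ be a finite connected G-vertex-transitive, G-locally semiprimitive graph and (x,y) an arc of Δ. Then G_{x,y}^{[1]} is a p-group for some prime p; moreover, either F*(G_{x,y}) is a p-group or G_{x,y}^{[1]} = 1. -/

import Mathlib

open Equiv Subgroup

/-- `N` (a subgroup of `Perm V`) acts transitively on the neighbourhood of `x`. -/
def transOn {V : Type*} (Δ : SimpleGraph V) (N : Subgroup (Equiv.Perm V)) (x : V) : Prop :=
  ∀ u ∈ Δ.neighborSet x, ∀ v ∈ Δ.neighborSet x, ∃ g ∈ N, g u = v

/-- The permutation group induced by `N` on the neighbourhood of `x` is semiregular. -/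
def semiregOn {V : Type*} (Δ : SimpleGraph V) (N : Subgroup (Equiv.Perm V)) (x : V) : Prop :=
  ∀ g ∈ N, (∃ u ∈ Δ.neighborSet x, g u = u) → ∀ v ∈ Δ.neighborSet x, g v = v

/-- The stabiliser `G_x`. -/
def vstab {V : Type*} (G : Subgroup (Equiv.Perm V)) (x : V) : Subgroup (Equiv.Perm V) :=
  G ⊓ MulAction.stabilizer (Equiv.Perm V) x

/-- `G_x^{[i]}`: pointwise stabiliser of the ball of radius `i` around `x`. -/
def ball {V : Type*} (Δ : SimpleGraph V) (G : Subgroup (Equiv.Perm V)) (x : V) (i : ℕ) :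
    Subgroup (Equiv.Perm V) :=
  G ⊓ ⨅ z ∈ {z : V | Δ.dist x z ≤ i}, MulAction.stabilizer (Equiv.Perm V) z

/-- `K` is a normal subgroup of `H` (both subgroups of `Perm V`). -/
def normalIn {V : Type*} (K H : Subgroup (Equiv.Perm V)) : Prop :=
  K ≤ H ∧ ∀ h ∈ H, ∀ k ∈ K, h * k * h⁻¹ ∈ K

/-- `O_p(H)`: the largest normal `p`-subgroup of `H`. -/
def Op {V : Type*} (p : ℕ) (H : Subgroup (Equiv.Perm V)) : Subgroup (Equiv.Perm V) :=
  sSup {K | normalIn K H ∧ IsPGroup p K}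

/-- `E_x = ⟨O_p(G_{x,z}) : z ∈ Δ(x)⟩`. -/
def Ep {V : Type*} (Δ : SimpleGraph V) (G : Subgroup (Equiv.Perm V)) (p : ℕ) (x : V) :
    Subgroup (Equiv.Perm V) :=
  ⨆ z ∈ Δ.neighborSet x, Op p (vstab G x ⊓ vstab G z)

/-- `C_{G_x}(G_x^{[1]})`. -/
def locCent {V : Type*} (Δ : SimpleGraph V) (G : Subgroup (Equiv.Perm V)) (x : V) :
    Subgroup (Equiv.Perm V) :=
  vstab G x ⊓ Subgroup.centralizer ((ball Δ G x 1 : Subgroup (Equiv.Perm V)) : Set (Equiv.Perm V))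

/-- Hypothesis (⋆). -/
def StarHyp {V : Type*} (Δ : SimpleGraph V) (G : Subgroup (Equiv.Perm V)) : Prop :=
  ∀ x : V,
    transOn Δ (vstab G x) x ∧
    (transOn Δ (locCent Δ G x) x ∨ semiregOn Δ (locCent Δ G x) x) ∧
    ∀ p : ℕ, p.Prime → (transOn Δ (Ep Δ G p x) x ∨ semiregOn Δ (Ep Δ G p x) x)

/-- `G` is a group of automorphisms of `Δ`. -/
def isAut {V : Type*} (Δ : SimpleGraph V) (G : Subgroup (Equiv.Perm V)) : Prop :=
  ∀ g ∈ G, ∀ u v : V, Δ.Adj (g u) (g v) ↔ Δ.Adj u v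

/-- `K` is a subnormal subgroup of `H`. -/
def subnormalIn {V : Type*} (K H : Subgroup (Equiv.Perm V)) : Prop :=
  ∃ (n : ℕ) (c : ℕ → Subgroup (Equiv.Perm V)),
    c 0 = K ∧ c n = H ∧ ∀ i < n, normalIn (c i) (c (i + 1))

/-- `K` is quasisimple: perfect and simple modulo its centre. -/
def IsQuasisimple {V : Type*} (K : Subgroup (Equiv.Perm V)) : Prop :=
  commutator ↥K = ⊤ ∧ IsSimpleGroup (↥K ⧸ Subgroup.center ↥K)

/-- `E(H)`: the layer, generated by the components of `H`. -/
def layer {V : Type*} (H : Subgroup (Equiv.Perm V)) : Subgroup (Equiv.Perm V) :=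
  sSup {K | subnormalIn K H ∧ IsQuasisimple K}

/-- `F(H)`: the Fitting subgroup of `H`. -/
def fitting {V : Type*} (H : Subgroup (Equiv.Perm V)) : Subgroup (Equiv.Perm V) :=
  sSup {K | normalIn K H ∧ Group.IsNilpotent ↥K}

/-- `F*(H) = E(H)F(H)`: the generalised Fitting subgroup of `H`. -/
def genFitting {V : Type*} (H : Subgroup (Equiv.Perm V)) : Subgroup (Equiv.Perm V) :=
  layer H ⊔ fitting H

section helpers

variable {V : Type*}

lemma mem_vstab {G : Subgroup (Equiv.Perm V)} {x : V} {g : Equiv.Perm V} :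
    g ∈ vstab G x ↔ g ∈ G ∧ g x = x := by
  simp [vstab, Subgroup.mem_inf, MulAction.mem_stabilizer_iff]

lemma mem_ball_one {Δ : SimpleGraph V} (hconn : Δ.Connected) {G : Subgroup (Equiv.Perm V)}
    {x : V} {g : Equiv.Perm V} :
    g ∈ ball Δ G x 1 ↔ g ∈ G ∧ g x = x ∧ ∀ z, Δ.Adj x z → g z = z := by
  simp only [ball, Subgroup.mem_inf, Subgroup.mem_iInf, Set.mem_ofPred_eq,
    MulAction.mem_stabilizer_iff, Equiv.Perm.smul_def]
  refine and_congr_right fun _ => ⟨fun h => ⟨h x (by simp), fun z hz => h z ?_⟩, ?_⟩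
  · exact (SimpleGraph.dist_eq_one_iff_adj.2 hz).le
  · rintro ⟨h1, h2⟩ z hz
    rcases Nat.le_one_iff_eq_zero_or_eq_one.1 hz with h | h
    · have := (hconn.dist_eq_zero_iff).1 h
      rw [← this]; exact h1
    · exact h2 z (SimpleGraph.dist_eq_one_iff_adj.1 h)

/-- The connectivity lemma. -/
lemma key {Δ : SimpleGraph V} {G : Subgroup (Equiv.Perm V)} (hconn : Δ.Connected)
    (hG : isAut Δ G) {x y : V} (hxy : Δ.Adj x y)
    (A B : Subgroup (Equiv.Perm V)) (hA : A ≤ vstab G x) (hB : B ≤ vstab G y)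
    (hAt : transOn Δ A x) (hBt : transOn Δ B y)
    (S : Set (Equiv.Perm V)) (hSx : ∀ s ∈ S, s x = x) (hSy : ∀ s ∈ S, s y = y)
    (hSA : ∀ a ∈ A, ∀ s ∈ S, a * s * a⁻¹ ∈ S) (hSB : ∀ a ∈ B, ∀ s ∈ S, a * s * a⁻¹ ∈ S) :
    ∀ s ∈ S, s = 1 := by
  -- every vertex is `g x` or `g y` for a `g ∈ G` whose inverse preserves `S`
  have claim : ∀ v : V, ∃ g ∈ G, (∀ s ∈ S, g⁻¹ * s * g ∈ S) ∧ (v = g x ∨ v = g y) := by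
    intro v
    have hr : Relation.ReflTransGen Δ.Adj x v :=
      (SimpleGraph.reachable_iff_reflTransGen _ _).1 (hconn.preconnected x v)
    induction hr with
    | refl => exact ⟨1, G.one_mem, by simp, Or.inl (by simp)⟩
    | @tail b c _ hbc ih =>
      obtain ⟨g, hg, hgS, h⟩ := ih
      have hadj : Δ.Adj (g⁻¹ b) (g⁻¹ c) := (hG _ (G.inv_mem hg) b c).2 hbc
      rcases h with rfl | rfl
      · obtain ⟨a, ha, hac⟩ := hAt y hxy (g⁻¹ c) (by simpa using hadj)
        refine ⟨g * a, G.mul_mem hg (mem_vstab.1 (hA ha)).1, ?_, Or.inr ?_⟩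
        · intro s hs
          have := hSA a⁻¹ (A.inv_mem ha) _ (hgS s hs)
          simpa [mul_assoc] using this
        · simp [hac]
      · obtain ⟨a, ha, hac⟩ := hBt x hxy.symm (g⁻¹ c) (by simpa using hadj)
        refine ⟨g * a, G.mul_mem hg (mem_vstab.1 (hB ha)).1, ?_, Or.inl ?_⟩
        · intro s hs
          have := hSB a⁻¹ (B.inv_mem ha) _ (hgS s hs)
          simpa [mul_assoc] using this
        · simp [hac]
  intro s hs
  ext v
  obtain ⟨g, -, hgS, rfl | rfl⟩ := claim v
  · have := hSx _ (hgS s hs)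
    simpa [Equiv.symm_apply_eq] using this
  · have := hSy _ (hgS s hs)
    simpa [Equiv.symm_apply_eq] using this

/-! ### Group theory -/

lemma normalIn_inf {K H : Subgroup (Equiv.Perm V)} (B : Subgroup (Equiv.Perm V))
    (h : normalIn K H) : normalIn (K ⊓ B) (H ⊓ B) := by
  refine ⟨inf_le_inf_right B h.1, fun a ha k hk => ⟨h.2 a ha.1 k hk.1, ?_⟩⟩
  exact B.mul_mem (B.mul_mem ha.2 hk.2) (B.inv_mem ha.2)

lemma normalIn_map {K H : Subgroup (Equiv.Perm V)} (f : Equiv.Perm V →* Equiv.Perm V)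
    (h : normalIn K H) : normalIn (K.map f) (H.map f) := by
  refine ⟨Subgroup.map_mono h.1, ?_⟩
  rintro _ ⟨a, ha, rfl⟩ _ ⟨k, hk, rfl⟩
  exact ⟨a * k * a⁻¹, h.2 a ha k hk, by simp⟩

lemma normalIn_refl (H : Subgroup (Equiv.Perm V)) : normalIn H H :=
  ⟨le_rfl, fun _ ha _ hk => H.mul_mem (H.mul_mem ha hk) (H.inv_mem ha)⟩

lemma subnormalIn_iff {K H : Subgroup (Equiv.Perm V)} :
    subnormalIn K H ↔ Relation.ReflTransGen normalIn K H := by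
  constructor
  · rintro ⟨n, c, rfl, rfl, hc⟩
    induction n with
    | zero => exact .refl
    | succ n ih =>
      exact (ih fun i hi => hc i (by omega)).tail (hc n (by omega))
  · intro h
    induction h using Relation.ReflTransGen.head_induction_on with
    | refl => exact ⟨0, fun _ => H, rfl, rfl, by simp⟩
    | @head a b hab _ ih =>
      obtain ⟨n, c, h0, hn, hc⟩ := ih
      refine ⟨n + 1, fun i => Nat.casesOn i a c, rfl, hn, ?_⟩
      intro i hi
      cases i with
      | zero => simpa [h0] using hab
      | succ i => exact hc i (by omega)

/-- Quasisimplicity without quotients. -/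
def QS (K : Subgroup (Equiv.Perm V)) : Prop :=
  ⁅K, K⁆ = K ∧ K ≠ ⊥ ∧ ∀ N, normalIn N K → N = K ∨ ⁅N, K⁆ = ⊥

lemma comm_eq_iff {K : Subgroup (Equiv.Perm V)} : commutator ↥K = ⊤ ↔ ⁅K, K⁆ = K := by
  have h : (commutator ↥K).map K.subtype = ⁅K, K⁆ := by
    rw [commutator_def, Subgroup.map_commutator]
    simp [← MonoidHom.range_eq_map]
  constructor
  · intro h1
    rw [h1] at h
    rw [← h]; simp [← MonoidHom.range_eq_map]
  · intro h1
    apply Subgroup.map_injective K.subtype_injective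
    rw [h, h1]; simp [← MonoidHom.range_eq_map]

lemma qs_iff {K : Subgroup (Equiv.Perm V)} : IsQuasisimple K ↔ QS K := by
  unfold IsQuasisimple QS
  rw [comm_eq_iff]
  constructor
  · rintro ⟨hp, hs⟩
    refine ⟨hp, ?_, ?_⟩
    · rintro rfl
      obtain ⟨a, b, hab⟩ := hs.exists_pair_ne
      exact hab (by
        induction a using QuotientGroup.induction_on
        induction b using QuotientGroup.induction_on
        congr 1
        exact Subsingleton.elim _ _)
    · intro N hN
      have hn : (N.subgroupOf K).Normal := ⟨fun n hn g => hN.2 g g.2 n hn⟩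
      have hn2 : ((N.subgroupOf K).map (QuotientGroup.mk' (Subgroup.center K))).Normal :=
        hn.map _ (QuotientGroup.mk'_surjective _)
      rcases hs.eq_bot_or_eq_top_of_normal _ hn2 with h | h
      · right
        rw [Subgroup.map_eq_bot_iff, QuotientGroup.ker_mk'] at h
        rw [Subgroup.commutator_eq_bot_iff_le_centralizer]
        intro n hnN
        have : (⟨n, hN.1 hnN⟩ : K) ∈ Subgroup.center K := h hnN
        rw [Subgroup.mem_centralizer_iff]
        intro k hk
        exact congrArg Subtype.val (Subgroup.mem_center_iff.1 this ⟨k, hk⟩)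
      · left
        apply le_antisymm hN.1
        -- every element of K is n * z
        have hnz : ∀ k ∈ K, ∃ n ∈ N, ∃ z, (∀ k' ∈ K, k' * z = z * k') ∧ k = n * z := by
          intro k hk
          have : QuotientGroup.mk' (Subgroup.center K) ⟨k, hk⟩ ∈
            (N.subgroupOf K).map (QuotientGroup.mk' (Subgroup.center K)) := by rw [h]; trivial
          obtain ⟨n, hn', hnk⟩ := this
          rw [QuotientGroup.mk'_eq_mk'] at hnk
          obtain ⟨z, hz, hzk⟩ := hnk
          refine ⟨n, hn', z, fun k' hk' => ?_, (congrArg Subtype.val hzk).symm⟩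
          exact congrArg Subtype.val (Subgroup.mem_center_iff.1 hz ⟨k', hk'⟩)
        rw [← hp, Subgroup.commutator_le]
        intro a ha b hb
        obtain ⟨n, hn1, z, hz, rfl⟩ := hnz a ha
        obtain ⟨m, hm1, w, hw, rfl⟩ := hnz b hb
        have hnK := hN.1 hn1
        have hmK := hN.1 hm1
        have hzK : z ∈ K := by simpa using K.mul_mem (K.inv_mem hnK) ha
        have hwK : w ∈ K := by simpa using K.mul_mem (K.inv_mem hmK) hb
        have : n * z * (m * w) * (n * z)⁻¹ * (m * w)⁻¹ = n * m * n⁻¹ * m⁻¹ := by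
          have e1 : n * z * (m * w) = n * m * w * z := by
            rw [mul_assoc n z, ← hz _ hb]; simp [mul_assoc]
          have e2 : (n * z)⁻¹ * (m * w)⁻¹ = z⁻¹ * w⁻¹ * n⁻¹ * m⁻¹ := by
            rw [mul_inv_rev, mul_inv_rev, mul_assoc z⁻¹, ← mul_assoc n⁻¹,
              hw n⁻¹ (K.inv_mem hnK)|> fun h => (by
                have h2 := hw n hnK
                have : Commute n⁻¹ w⁻¹ := (show Commute n w from h2).inv_inv
                exact this.eq : n⁻¹ * w⁻¹ = w⁻¹ * n⁻¹)]
            simp [mul_assoc]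
          rw [mul_assoc (n * z * (m * w)), e1, e2]
          simp [mul_assoc]
        rw [commutatorElement_def, this]
        exact N.mul_mem (N.mul_mem (N.mul_mem hn1 hm1) (N.inv_mem hn1)) (N.inv_mem hm1)
  · rintro ⟨hp, hne, hN⟩
    refine ⟨hp, ?_⟩
    have hnt : Nontrivial (K ⧸ Subgroup.center K) := by
      rw [← not_subsingleton_iff_nontrivial]
      intro hsub
      have hc : Subgroup.center K = ⊤ := QuotientGroup.subgroup_eq_top_of_subsingleton _ hsub
      apply hne
      rw [← hp, Subgroup.commutator_eq_bot_iff_le_centralizer]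
      intro n hn
      rw [Subgroup.mem_centralizer_iff]
      intro k hk
      have : (⟨n, hn⟩ : K) ∈ Subgroup.center K := by rw [hc]; trivial
      exact congrArg Subtype.val (Subgroup.mem_center_iff.1 this ⟨k, hk⟩)
    refine { eq_bot_or_eq_top_of_normal := fun M hM => ?_ }
    have hC : (M.comap (QuotientGroup.mk' (Subgroup.center K))).Normal := hM.comap _
    have hn : normalIn ((M.comap (QuotientGroup.mk' (Subgroup.center K))).map K.subtype) K := by
      refine ⟨Subgroup.map_subtype_le _, ?_⟩
      rintro h hh _ ⟨k, hk, rfl⟩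
      exact ⟨⟨h, hh⟩ * k * ⟨h, hh⟩⁻¹, hC.conj_mem k hk ⟨h, hh⟩, rfl⟩
    rcases hN _ hn with h | h
    · right
      rw [eq_top_iff]
      intro q _
      obtain ⟨k, rfl⟩ := QuotientGroup.mk'_surjective _ q
      have : (k : Equiv.Perm V) ∈
        (M.comap (QuotientGroup.mk' (Subgroup.center K))).map K.subtype := by rw [h]; exact k.2
      obtain ⟨k', hk', e⟩ := this
      have : k' = k := Subtype.ext e
      subst this
      exact hk'
    · left
      rw [eq_bot_iff]
      intro q hq
      obtain ⟨k, rfl⟩ := QuotientGroup.mk'_surjective _ q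
      rw [Subgroup.commutator_eq_bot_iff_le_centralizer] at h
      have hk := h ⟨k, hq, rfl⟩
      rw [Subgroup.mem_centralizer_iff] at hk
      rw [Subgroup.mem_bot]
      refine (QuotientGroup.eq_one_iff k).2 (Subgroup.mem_center_iff.2 fun g => Subtype.ext ?_)
      exact hk g g.2

lemma map_conj_inv (g : Equiv.Perm V) (K : Subgroup (Equiv.Perm V)) :
    (K.map (MulAut.conj g⁻¹).toMonoidHom).map (MulAut.conj g).toMonoidHom = K := by
  ext k
  simp only [Subgroup.mem_map]
  constructor
  · rintro ⟨_, ⟨a, ha, rfl⟩, rfl⟩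
    simpa [mul_assoc] using ha
  · intro hk
    exact ⟨_, ⟨k, hk, rfl⟩, by simp [mul_assoc]⟩

lemma qs_map {K : Subgroup (Equiv.Perm V)} (g : Equiv.Perm V) (h : QS K) :
    QS (K.map (MulAut.conj g).toMonoidHom) := by
  obtain ⟨h1, h2, h3⟩ := h
  have hinj : Function.Injective (MulAut.conj g).toMonoidHom := (MulAut.conj g).injective
  refine ⟨?_, ?_, ?_⟩
  · rw [← Subgroup.map_commutator, h1]
  · rwa [Ne, Subgroup.map_eq_bot_iff_of_injective _ hinj]
  · intro N hN
    have hN' := normalIn_map (MulAut.conj g⁻¹).toMonoidHom hN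
    have e : (K.map (MulAut.conj g).toMonoidHom).map (MulAut.conj g⁻¹).toMonoidHom = K := by
      simpa using map_conj_inv g⁻¹ K
    rw [e] at hN'
    rcases h3 _ hN' with h | h
    · left
      rw [← h, map_conj_inv]
    · right
      have := congrArg (Subgroup.map (MulAut.conj g).toMonoidHom) h
      rwa [Subgroup.map_commutator, map_conj_inv, Subgroup.map_bot] at this

/-- Components. -/
def Comp (L H : Subgroup (Equiv.Perm V)) : Prop := Relation.ReflTransGen normalIn L H ∧ QS L

lemma subn_le {L H : Subgroup (Equiv.Perm V)} (h : Relation.ReflTransGen normalIn L H) :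
    L ≤ H := by
  induction h with
  | refl => exact le_rfl
  | tail _ h ih => exact ih.trans h.1

lemma subn_inf {L H : Subgroup (Equiv.Perm V)} (B : Subgroup (Equiv.Perm V))
    (h : Relation.ReflTransGen normalIn L H) (hL : L ≤ B) (hB : B ≤ H) :
    Relation.ReflTransGen normalIn L B := by
  have := Relation.ReflTransGen.lift (p := normalIn) (fun K => K ⊓ B)
    (fun a b hab => normalIn_inf B hab) L H h
  simpa [Function.onFun, inf_eq_left.2 hL, inf_eq_right.2 hB] using this

lemma comp_map {L H : Subgroup (Equiv.Perm V)} (g : Equiv.Perm V) (h : Comp L H) :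
    Comp (L.map (MulAut.conj g).toMonoidHom) (H.map (MulAut.conj g).toMonoidHom) :=
  ⟨Relation.ReflTransGen.lift (p := normalIn) (Subgroup.map (MulAut.conj g).toMonoidHom)
    (fun _ _ hab => normalIn_map _ hab) L H h.1,
    qs_map g h.2⟩

lemma comm_le_right {H M N : Subgroup (Equiv.Perm V)} (hM : M ≤ H) (hN : normalIn N H) :
    ⁅M, N⁆ ≤ N := by
  rw [Subgroup.commutator_le]
  intro a ha b hb
  exact N.mul_mem (hN.2 a (hM ha) b hb) (N.inv_mem hb)

lemma comp_dichotomy {L H : Subgroup (Equiv.Perm V)} (h : Comp L H) :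
    ∀ N, normalIn N H → L ≤ N ∨ ⁅L, N⁆ = ⊥ := by
  obtain ⟨hs, hq⟩ := h
  induction hs with
  | refl =>
    intro N hN
    rcases hq.2.2 N hN with h | h
    · exact Or.inl h.ge
    · right; rwa [Subgroup.commutator_comm]
  | @tail M H hLM hMH ih =>
    intro N hN
    have hNM : normalIn (N ⊓ M) M := by
      have := normalIn_inf M hN
      rwa [inf_eq_right.2 hMH.1] at this
    rcases ih _ hNM with h | h
    · exact Or.inl (h.trans inf_le_left)
    · right
      have hLM' : L ≤ M := subn_le hLM
      have h1 : ⁅L, N⁆ ≤ N ⊓ M := by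
        refine le_inf (comm_le_right (hLM'.trans hMH.1) hN) ?_
        rw [Subgroup.commutator_comm]
        exact (Subgroup.commutator_mono le_rfl hLM').trans (comm_le_right hN.1 hMH)
      have h2 : ⁅⁅L, N⁆, L⁆ = ⊥ := by
        rw [Subgroup.commutator_comm, eq_bot_iff, ← h]
        exact Subgroup.commutator_mono le_rfl h1
      have h3 : ⁅⁅N, L⁆, L⁆ = ⊥ := by rwa [Subgroup.commutator_comm N L]
      have := Subgroup.commutator_commutator_eq_bot_of_rotate h2 h3
      rwa [hq.1] at this

/-! ### `O_p` -/

lemma le_Op {p : ℕ} {K H : Subgroup (Equiv.Perm V)} (h : normalIn K H) (hp : IsPGroup p K) :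
    K ≤ Op p H := le_sSup ⟨h, hp⟩

lemma normalIn_sup {K N H : Subgroup (Equiv.Perm V)} (h : normalIn K H) (h' : normalIn N H) :
    normalIn (K ⊔ N) H := by
  refine ⟨sup_le h.1 h'.1, fun g hg k hk => ?_⟩
  have : K ⊔ N ≤ (K ⊔ N).comap (MulAut.conj g).toMonoidHom := by
    refine sup_le (fun a ha => ?_) (fun a ha => ?_)
    · exact (le_sup_left : K ≤ K ⊔ N) (h.2 g hg a ha)
    · exact (le_sup_right : N ≤ K ⊔ N) (h'.2 g hg a ha)
  exact this hk

lemma Op_spec [Finite V] (p : ℕ) (H : Subgroup (Equiv.Perm V)) :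
    normalIn (Op p H) H ∧ IsPGroup p (Op p H) := by
  classical
  have hfin : {K : Subgroup (Equiv.Perm V) | normalIn K H ∧ IsPGroup p K}.Finite := Set.toFinite _
  obtain ⟨M, hM⟩ := hfin.exists_maximal ⟨⊥, ⟨bot_le, by simp⟩, IsPGroup.of_bot⟩
  have : Op p H = M := by
    apply le_antisymm
    · refine sSup_le fun K hK => ?_
      have : normalIn (K ⊔ M) H ∧ IsPGroup p (K ⊔ M : Subgroup _) := by
        refine ⟨normalIn_sup hK.1 hM.1.1, ?_⟩
        refine IsPGroup.to_sup_of_normal_right' hK.2 hM.1.2 ?_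
        intro k hk
        rw [Subgroup.mem_normalizer_iff]
        intro n
        refine ⟨fun hn => hM.1.1.2 k (hK.1.1 hk) n hn, fun hn => ?_⟩
        have := hM.1.1.2 k⁻¹ (H.inv_mem (hK.1.1 hk)) _ hn
        simpa [mul_assoc] using this
      exact le_sup_left.trans (hM.2 this le_sup_right)
    · exact le_sSup hM.1
  rw [this]; exact hM.1

lemma Op_conj {p : ℕ} {H H' : Subgroup (Equiv.Perm V)} (g : Equiv.Perm V)
    (h : H.map (MulAut.conj g).toMonoidHom = H') {r : Equiv.Perm V} (hr : r ∈ Op p H) :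
    g * r * g⁻¹ ∈ Op p H' := by
  have : Op p H ≤ (Op p H').comap (MulAut.conj g).toMonoidHom := by
    refine sSup_le fun K hK => ?_
    rw [← Subgroup.map_le_iff_le_comap]
    refine le_Op ?_ (hK.2.map _)
    rw [← h]
    exact normalIn_map _ hK.1
  exact this hr

lemma map_conj_eq {H H' : Subgroup (Equiv.Perm V)} (g : Equiv.Perm V)
    (h1 : ∀ h ∈ H, g * h * g⁻¹ ∈ H') (h2 : ∀ h ∈ H', g⁻¹ * h * g ∈ H) :
    H.map (MulAut.conj g).toMonoidHom = H' := by
  apply le_antisymm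
  · rintro _ ⟨h, hh, rfl⟩
    exact h1 h hh
  · intro h hh
    exact ⟨_, h2 h hh, by simp [mul_assoc]⟩

lemma map_conj_normal {K H : Subgroup (Equiv.Perm V)} (hK : normalIn K H) {g : Equiv.Perm V}
    (hg : g ∈ H) : K.map (MulAut.conj g).toMonoidHom = K := by
  refine map_conj_eq g (hK.2 g hg) fun k hk => ?_
  have := hK.2 g⁻¹ (H.inv_mem hg) k hk
  simpa using this

lemma Op_normal [Finite V] {p : ℕ} {K H : Subgroup (Equiv.Perm V)} (hK : normalIn K H) :
    normalIn (Op p K) H :=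
  ⟨(Op_spec p K).1.1.trans hK.1, fun _ hg _ hr => Op_conj _ (map_conj_normal hK hg) hr⟩

lemma Op_mono [Finite V] {p : ℕ} {K H : Subgroup (Equiv.Perm V)} (hK : normalIn K H) :
    Op p K ≤ Op p H := le_Op (Op_normal hK) (Op_spec p K).2

lemma Op_subn [Finite V] {p : ℕ} {K H : Subgroup (Equiv.Perm V)}
    (h : Relation.ReflTransGen normalIn K H) : Op p K ≤ Op p H := by
  induction h with
  | refl => exact le_rfl
  | tail _ h ih => exact ih.trans (Op_mono h)

/-- If `F*(H) = 1` then `H = 1`. -/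
lemma eq_bot_of [Finite V] {H : Subgroup (Equiv.Perm V)} (hL : ∀ L, ¬ Comp L H)
    (hO : ∀ p : ℕ, p.Prime → Op p H = ⊥) : H = ⊥ := by
  by_contra hne
  have hfin : {K : Subgroup (Equiv.Perm V) |
    Relation.ReflTransGen normalIn K H ∧ K ≠ ⊥}.Finite := Set.toFinite _
  obtain ⟨S, hS⟩ := hfin.exists_minimal ⟨H, .refl, hne⟩
  have hmin : ∀ N, normalIn N S → N = S ∨ N = ⊥ := by
    intro N hN
    by_cases hb : N = ⊥
    · exact Or.inr hb
    · exact Or.inl (le_antisymm hN.1 (hS.2 ⟨Relation.ReflTransGen.head hN hS.1.1, hb⟩ hN.1))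
  have hcn : normalIn ⁅S, S⁆ S := by
    have hle : ⁅S, S⁆ ≤ S := Subgroup.commutator_le_self S
    exact ⟨hle, fun g hg k hk => S.mul_mem (S.mul_mem hg (hle hk)) (S.inv_mem hg) |> fun _ => by
      have : ⁅S, S⁆.map (MulAut.conj g).toMonoidHom = ⁅S, S⁆ := by
        rw [Subgroup.map_commutator, map_conj_normal (normalIn_refl S) hg]
      rw [← this]
      exact ⟨k, hk, rfl⟩⟩
  rcases hmin _ hcn with h | h
  · refine hL S ⟨hS.1.1, h, hS.1.2, fun N hN => ?_⟩
    rcases hmin N hN with h | h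
    · exact Or.inl h
    · right; rw [h]; exact Subgroup.commutator_bot_left S
  · have hcard : Nat.card S ≠ 1 := by
      rw [Ne, Subgroup.card_eq_one]; exact hS.1.2
    obtain ⟨p, hp, hpd⟩ := Nat.exists_prime_and_dvd hcard
    have : Fact p.Prime := ⟨hp⟩
    obtain ⟨s, hs⟩ := exists_prime_orderOf_dvd_card' p hpd
    have hzn : normalIn (Subgroup.zpowers (s : Equiv.Perm V)) S := by
      refine ⟨by simp, fun g hg k hk => ?_⟩
      rw [Subgroup.commutator_eq_bot_iff_le_centralizer] at h
      have hkS : k ∈ S := (by simp : Subgroup.zpowers (s : Equiv.Perm V) ≤ S) hk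
      have := Subgroup.mem_centralizer_iff.1 (h hkS) g hg
      rw [this]; simpa using hk
    have ho : orderOf (s : Equiv.Perm V) = p := by rw [Subgroup.orderOf_coe]; exact hs
    rcases hmin _ hzn with h' | h'
    · have hpg : IsPGroup p S := by
        rw [← h']
        refine IsPGroup.of_card (n := 1) ?_
        rw [Nat.card_zpowers, ho, pow_one]
      have h1 : S ≤ Op p H := (le_Op (normalIn_refl S) hpg).trans (Op_subn hS.1.1)
      rw [hO p hp, le_bot_iff] at h1
      exact hS.1.2 h1
    · rw [Subgroup.zpowers_eq_bot] at h'
      rw [h', orderOf_one] at ho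
      exact hp.one_lt.ne ho

lemma isPGroup_of_no_coprime [Finite V] {p : ℕ} (hp : p.Prime) {K : Subgroup (Equiv.Perm V)}
    (h : ∀ k ∈ K, (∃ m : ℕ, m.Coprime p ∧ k ^ m = 1) → k = 1) : IsPGroup p K := by
  intro k
  have hpos : orderOf (k : Equiv.Perm V) ≠ 0 := (orderOf_pos _).ne'
  obtain ⟨n, m, hm, hnm⟩ := Nat.exists_eq_pow_mul_and_not_dvd hpos p hp.ne_one
  refine ⟨n, Subtype.ext ?_⟩
  simp only [Subgroup.coe_pow, Subgroup.coe_one]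
  refine h _ (K.pow_mem k.2 _) ⟨m, ((Nat.Prime.coprime_iff_not_dvd hp).2 hm).symm, ?_⟩
  rw [← pow_mul, ← hnm, pow_orderOf_eq_one]

lemma fitting_le [Finite V] {p : ℕ} (hp : p.Prime) {H : Subgroup (Equiv.Perm V)}
    (hO : ∀ q : ℕ, q.Prime → q ≠ p → Op q H = ⊥) : fitting H ≤ Op p H := by
  refine sSup_le fun K ⟨hK, hnil⟩ => le_Op hK ?_
  have hsyl : ∀ (q : ℕ) (_ : Fact q.Prime) (P : Sylow q K), (P : Subgroup K).Normal :=
    ((Group.isNilpotent_of_finite_tfae (G := K)).out 0 3).1 hnil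
  -- every element of order a prime `q ≠ p` is trivial
  have hq : ∀ q : ℕ, q.Prime → q ≠ p → ∀ k : K, orderOf k ≠ q := by
    intro q hq hqp k hk
    have : Fact q.Prime := ⟨hq⟩
    obtain ⟨P⟩ : Nonempty (Sylow q K) := inferInstance
    have hPn := hsyl q ⟨hq⟩ P
    have hPc : (P : Subgroup K).Characteristic := P.characteristic_of_normal hPn
    have hkP : k ∈ (P : Subgroup K) := by
      have hz : IsPGroup q (Subgroup.zpowers k) := by
        refine IsPGroup.of_card (n := 1) ?_
        rw [Nat.card_zpowers, hk, pow_one]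
      obtain ⟨Q, hQ⟩ := hz.exists_le_sylow
      have := Sylow.unique_of_normal P hPn
      rw [Subsingleton.elim P Q]
      exact hQ (Subgroup.mem_zpowers k)
    have hPH : normalIn ((P : Subgroup K).map K.subtype) H := by
      refine ⟨(Subgroup.map_subtype_le _).trans hK.1, ?_⟩
      rintro h hh _ ⟨a, ha, rfl⟩
      let φ : K ≃* K :=
        { toFun := fun a => ⟨h * a * h⁻¹, hK.2 h hh a a.2⟩
          invFun := fun a => ⟨h⁻¹ * a * h, by
            have := hK.2 h⁻¹ (H.inv_mem hh) a a.2
            simpa using this⟩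
          left_inv := fun a => Subtype.ext (by simp [mul_assoc])
          right_inv := fun a => Subtype.ext (by simp [mul_assoc])
          map_mul' := fun a b => Subtype.ext (by simp [mul_assoc]) }
      refine ⟨φ a, ?_, rfl⟩
      have := hPc.fixed φ
      have h2 : a ∈ (P : Subgroup K).comap φ.toMonoidHom := by rw [this]; exact ha
      exact h2
    have h1 := le_Op hPH (P.isPGroup'.map _)
    rw [hO q hq hqp, le_bot_iff] at h1
    have h2 : (k : Equiv.Perm V) ∈ (P : Subgroup K).map K.subtype := ⟨k, hkP, rfl⟩
    rw [h1, Subgroup.mem_bot] at h2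
    have h3 : k = 1 := Subtype.ext h2
    rw [h3, orderOf_one] at hk
    exact hq.one_lt.ne hk
  apply isPGroup_of_no_coprime hp
  rintro k hk ⟨m, hm, hkm⟩
  by_contra hne
  have ho : orderOf (⟨k, hk⟩ : K) ≠ 1 := by
    rw [Ne, orderOf_eq_one_iff]
    intro h
    exact hne (congrArg Subtype.val h)
  obtain ⟨q, hqp, hqd⟩ := Nat.exists_prime_and_dvd ho
  have hdm : orderOf (⟨k, hk⟩ : K) ∣ m := orderOf_dvd_of_pow_eq_one (Subtype.ext hkm)
  have hqne : q ≠ p := by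
    rintro rfl
    have := Nat.dvd_gcd (hqd.trans hdm) dvd_rfl
    rw [Nat.Coprime] at hm
    rw [hm] at this
    exact hqp.one_lt.ne' (Nat.dvd_one.1 this)
  have : Fact q.Prime := ⟨hqp⟩
  obtain ⟨s, hs⟩ := exists_prime_orderOf_dvd_card' q
    (hqd.trans (orderOf_dvd_natCard (⟨k, hk⟩ : K)))
  exact hq q hqp hqne s hs

/-! ### Equivariance -/

lemma ball_conj {Δ : SimpleGraph V} {G : Subgroup (Equiv.Perm V)} (hconn : Δ.Connected)
    (hG : isAut Δ G) {g : Equiv.Perm V} (hg : g ∈ G) (u : V) {h : Equiv.Perm V}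
    (hh : h ∈ ball Δ G u 1) : g * h * g⁻¹ ∈ ball Δ G (g u) 1 := by
  rw [mem_ball_one hconn] at hh ⊢
  refine ⟨G.mul_mem (G.mul_mem hg hh.1) (G.inv_mem hg), by simp [hh.2.1], fun z hz => ?_⟩
  have : Δ.Adj u (g⁻¹ z) := by
    have := (hG _ (G.inv_mem hg) _ _).2 hz
    simpa using this
  rw [Equiv.Perm.mul_apply, Equiv.Perm.mul_apply, hh.2.2 _ this]; simp

lemma vstab_conj {G : Subgroup (Equiv.Perm V)} {g : Equiv.Perm V} (hg : g ∈ G) (u : V)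
    {h : Equiv.Perm V} (hh : h ∈ vstab G u) : g * h * g⁻¹ ∈ vstab G (g u) := by
  rw [mem_vstab] at hh ⊢
  exact ⟨G.mul_mem (G.mul_mem hg hh.1) (G.inv_mem hg), by simp [hh.2]⟩

lemma vstab2_conj {G : Subgroup (Equiv.Perm V)} {g : Equiv.Perm V} (hg : g ∈ G) (u z : V) :
    (vstab G u ⊓ vstab G z).map (MulAut.conj g).toMonoidHom =
      vstab G (g u) ⊓ vstab G (g z) := by
  refine map_conj_eq g (fun h hh => ⟨vstab_conj hg u hh.1, vstab_conj hg z hh.2⟩)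
    (fun h hh => ⟨?_, ?_⟩)
  · simpa using vstab_conj (G.inv_mem hg) _ hh.1
  · simpa using vstab_conj (G.inv_mem hg) _ hh.2

lemma Ep_conj {Δ : SimpleGraph V} {G : Subgroup (Equiv.Perm V)} (p : ℕ)
    (hG : isAut Δ G) {g : Equiv.Perm V} (hg : g ∈ G) (u : V) {h : Equiv.Perm V}
    (hh : h ∈ Ep Δ G p u) : g * h * g⁻¹ ∈ Ep Δ G p (g u) := by
  have : Ep Δ G p u ≤ (Ep Δ G p (g u)).comap (MulAut.conj g).toMonoidHom := by
    refine iSup₂_le fun z hz r hr => ?_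
    have h1 := Op_conj g (vstab2_conj hg u z) hr
    have h2 : Op p (vstab G (g u) ⊓ vstab G (g z)) ≤ Ep Δ G p (g u) :=
      le_iSup₂_of_le (g z) ((hG g hg u z).2 hz) le_rfl
    exact h2 h1
  exact this hh

lemma locCent_conj {Δ : SimpleGraph V} {G : Subgroup (Equiv.Perm V)} (hconn : Δ.Connected)
    (hG : isAut Δ G) {g : Equiv.Perm V} (hg : g ∈ G) (u : V) {h : Equiv.Perm V}
    (hh : h ∈ locCent Δ G u) : g * h * g⁻¹ ∈ locCent Δ G (g u) := by
  refine ⟨vstab_conj hg u hh.1, ?_⟩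
  refine Subgroup.mem_centralizer_iff.2 ?_
  intro b hb
  have hb' : g⁻¹ * b * g ∈ ball Δ G u 1 := by
    simpa using ball_conj hconn hG (G.inv_mem hg) _ hb
  have := Subgroup.mem_centralizer_iff.1 hh.2 _ hb'
  calc b * (g * h * g⁻¹) = g * (g⁻¹ * b * g * h) * g⁻¹ := by group
    _ = g * (h * (g⁻¹ * b * g)) * g⁻¹ := by rw [this]
    _ = _ := by group

lemma trans_conj {Δ : SimpleGraph V} {G : Subgroup (Equiv.Perm V)} (hG : isAut Δ G)
    (F : V → Subgroup (Equiv.Perm V))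
    (hF : ∀ g ∈ G, ∀ u, ∀ h ∈ F u, g * h * g⁻¹ ∈ F (g u))
    (hvt : ∀ u v : V, ∃ g ∈ G, g u = v) {x : V} (h : transOn Δ (F x) x) (w : V) :
    transOn Δ (F w) w := by
  obtain ⟨g, hg, rfl⟩ := hvt x w
  intro u hu v hv
  have hu' : Δ.Adj x (g⁻¹ u) := by simpa using (hG _ (G.inv_mem hg) _ _).2 hu
  have hv' : Δ.Adj x (g⁻¹ v) := by simpa using (hG _ (G.inv_mem hg) _ _).2 hv
  obtain ⟨a, ha, hav⟩ := h _ hu' _ hv'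
  refine ⟨g * a * g⁻¹, hF g hg x a ha, ?_⟩
  rw [Equiv.Perm.mul_apply, Equiv.Perm.mul_apply, hav]; simp

lemma normalIn_of_equiv {G : Subgroup (Equiv.Perm V)}
    (F : V → Subgroup (Equiv.Perm V))
    (hF : ∀ g ∈ G, ∀ u, ∀ h ∈ F u, g * h * g⁻¹ ∈ F (g u)) {x : V} (hle : F x ≤ vstab G x) :
    normalIn (F x) (vstab G x) := by
  refine ⟨hle, fun g hg k hk => ?_⟩
  have hg' := mem_vstab.1 hg
  have := hF g hg'.1 x k hk
  rwa [hg'.2] at this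

lemma ball_normal {Δ : SimpleGraph V} {G : Subgroup (Equiv.Perm V)} (hconn : Δ.Connected)
    (hG : isAut Δ G) (x : V) : normalIn (ball Δ G x 1) (vstab G x) :=
  normalIn_of_equiv (fun u => ball Δ G u 1) (fun _ hg u _ hh => ball_conj hconn hG hg u hh)
    (fun h hh => mem_vstab.2 ⟨((mem_ball_one hconn).1 hh).1, ((mem_ball_one hconn).1 hh).2.1⟩)

lemma ball_le {Δ : SimpleGraph V} {G : Subgroup (Equiv.Perm V)} (hconn : Δ.Connected)
    {x y : V} (hxy : Δ.Adj x y) : ball Δ G x 1 ≤ vstab G x ⊓ vstab G y := by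
  intro h hh
  obtain ⟨h1, h2, h3⟩ := (mem_ball_one hconn).1 hh
  exact ⟨mem_vstab.2 ⟨h1, h2⟩, mem_vstab.2 ⟨h1, h3 y hxy⟩⟩

lemma ball_normal2 {Δ : SimpleGraph V} {G : Subgroup (Equiv.Perm V)} (hconn : Δ.Connected)
    (hG : isAut Δ G) {x y : V} (hxy : Δ.Adj x y) :
    normalIn (ball Δ G x 1) (vstab G x ⊓ vstab G y) :=
  ⟨ball_le hconn hxy, fun h hh => (ball_normal hconn hG x).2 h hh.1⟩

lemma Ep_le {Δ : SimpleGraph V} {G : Subgroup (Equiv.Perm V)} (p : ℕ) (x : V) :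
    Ep Δ G p x ≤ vstab G x :=
  iSup₂_le fun _ _ => sSup_le fun _ hK => hK.1.1.trans inf_le_left

/-- One side of the argument that `E_x` preserves the set of elements of order prime to p of `K`. -/
lemma Ep_preserves [Finite V] {Δ : SimpleGraph V} {G : Subgroup (Equiv.Perm V)}
    (hconn : Δ.Connected) (hG : isAut Δ G) {x : V} {p : ℕ} {K : Subgroup (Equiv.Perm V)}
    (hK : normalIn K (ball Δ G x 1)) :
    ∀ a ∈ Ep Δ G p x, ∀ s ∈ {k | k ∈ K ∧ ∃ m : ℕ, m.Coprime p ∧ k ^ m = 1},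
      a * s * a⁻¹ ∈ {k | k ∈ K ∧ ∃ m : ℕ, m.Coprime p ∧ k ^ m = 1} := by
  intro a ha
  unfold Ep at ha
  simp only [iSup_subtype'] at ha
  induction ha using Subgroup.iSup_induction' with
  | h1 => intro s hs; simpa using hs
  | hmul a b _ _ iha ihb =>
    intro s hs
    have := iha _ (ihb s hs)
    simpa [mul_assoc] using this
  | hp z e he =>
    obtain ⟨z, hz⟩ := z
    rintro k ⟨hk, m, hm, hkm⟩
    obtain ⟨hRn, hRp⟩ := Op_spec p (vstab G x ⊓ vstab G z)
    have hkb : k ∈ ball Δ G x 1 := hK.1 hk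
    have heH := hRn.1 he
    set q := e * k * e⁻¹ * k⁻¹ with hqdef
    have hqR : q ∈ Op p (vstab G x ⊓ vstab G z) := by
      have := hRn.2 k (ball_le hconn hz hkb) _ (Subgroup.inv_mem _ he)
      have := Subgroup.mul_mem _ he this
      simpa [hqdef, mul_assoc] using this
    have hqb : q ∈ ball Δ G x 1 :=
      Subgroup.mul_mem _ ((ball_normal hconn hG x).2 e heH.1 k hkb) (Subgroup.inv_mem _ hkb)
    have hpow : (e * k * e⁻¹) ^ m = 1 := by rw [conj_pow, hkm]; simp
    have hqk : e * k * e⁻¹ = q * k := by simp [hqdef]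
    have hind : ∀ n : ℕ, ∃ k' ∈ K, (q * k) ^ n = q ^ n * k' := by
      intro n
      induction n with
      | zero => exact ⟨1, K.one_mem, by simp⟩
      | succ n ih =>
        obtain ⟨k', hk', h⟩ := ih
        refine ⟨q⁻¹ * k' * q * k, K.mul_mem ?_ hk, ?_⟩
        · have := hK.2 q⁻¹ (Subgroup.inv_mem _ hqb) k' hk'
          simpa using this
        · rw [pow_succ, h, pow_succ]; group
    obtain ⟨k', hk', h⟩ := hind m
    rw [← hqk, hpow] at h
    have hqm : q ^ m ∈ K := by
      rw [eq_inv_of_mul_eq_one_left h.symm]; exact K.inv_mem hk'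
    obtain ⟨n, hn⟩ := hRp ⟨q, hqR⟩
    have hn' : q ^ p ^ n = 1 := congrArg Subtype.val hn
    have hcop : IsCoprime (m : ℤ) ((p ^ n : ℕ) : ℤ) :=
      Nat.isCoprime_iff_coprime.2 (Nat.Coprime.pow_right n hm)
    obtain ⟨u, v, huv⟩ := hcop
    have hqK : q ∈ K := by
      have : q = (q ^ m) ^ u * (q ^ p ^ n) ^ v := by
        rw [← zpow_natCast q m, ← zpow_natCast q (p ^ n), ← zpow_mul, ← zpow_mul, ← zpow_add,
          mul_comm (m : ℤ), mul_comm ((p ^ n : ℕ) : ℤ), huv, zpow_one]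
      rw [this, hn', one_zpow, mul_one]
      exact K.zpow_mem hqm u
    refine ⟨?_, m, hm, hpow⟩
    rw [hqk]
    exact K.mul_mem hqK hk

end helpers

theorem stmt13 {V : Type*} [Fintype V] (Δ : SimpleGraph V) (G : Subgroup (Equiv.Perm V))
    (hconn : Δ.Connected) (hG : isAut Δ G)
    (hvt : ∀ u v : V, ∃ g ∈ G, g u = v)
    (hsp : ∀ x : V, transOn Δ (vstab G x) x ∧
      ∀ N : Subgroup (Equiv.Perm V), normalIn N (vstab G x) →
        transOn Δ N x ∨ semiregOn Δ N x)
    {x y : V} (hxy : Δ.Adj x y) :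
    (∃ p : ℕ, p.Prime ∧ IsPGroup p ↥(ball Δ G x 1 ⊓ ball Δ G y 1)) ∧
    ((∃ p : ℕ, p.Prime ∧ IsPGroup p ↥(genFitting (vstab G x ⊓ vstab G y))) ∨
      ball Δ G x 1 ⊓ ball Δ G y 1 = ⊥) := by
  have htriv : ball Δ G x 1 ⊓ ball Δ G y 1 = ⊥ →
      (∃ p : ℕ, p.Prime ∧ IsPGroup p ↥(ball Δ G x 1 ⊓ ball Δ G y 1)) ∧
      ((∃ p : ℕ, p.Prime ∧ IsPGroup p ↥(genFitting (vstab G x ⊓ vstab G y))) ∨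
        ball Δ G x 1 ⊓ ball Δ G y 1 = ⊥) := by
    intro h
    refine ⟨⟨2, Nat.prime_two, ?_⟩, Or.inr h⟩
    rw [h]; exact IsPGroup.of_bot
  have hKx : ∀ s ∈ ball Δ G x 1 ⊓ ball Δ G y 1, s x = x :=
    fun s hs => ((mem_ball_one hconn).1 hs.1).2.1
  have hKy : ∀ s ∈ ball Δ G x 1 ⊓ ball Δ G y 1, s y = y :=
    fun s hs => ((mem_ball_one hconn).1 hs.2).2.1
  have hcc : ∀ u, ∀ a ∈ locCent Δ G u, ∀ s ∈ ball Δ G u 1, a * s * a⁻¹ = s := by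
    intro u a ha s hs
    have := Subgroup.mem_centralizer_iff.1 ha.2 s hs
    rw [← this]; simp
  have hlocF : ∀ g ∈ G, ∀ u, ∀ h ∈ locCent Δ G u, g * h * g⁻¹ ∈ locCent Δ G (g u) :=
    fun g hg u h hh => locCent_conj hconn hG hg u hh
  by_cases hloc : ∃ u, transOn Δ (locCent Δ G u) u
  · obtain ⟨u, hu⟩ := hloc
    have ht := trans_conj hG _ hlocF hvt hu
    apply htriv
    rw [eq_bot_iff]
    intro s hs
    refine key hconn hG hxy (locCent Δ G x) (locCent Δ G y) inf_le_left inf_le_left (ht x) (ht y)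
      ((ball Δ G x 1 ⊓ ball Δ G y 1 : Subgroup (Equiv.Perm V)) : Set (Equiv.Perm V)) hKx hKy
      ?_ ?_ s hs
    · intro a ha s hs
      rw [hcc x a ha s hs.1]; exact hs
    · intro a ha s hs
      rw [hcc y a ha s hs.2]; exact hs
  have hlocs : ∀ u, semiregOn Δ (locCent Δ G u) u := fun u =>
    ((hsp u).2 _ (normalIn_of_equiv _ hlocF inf_le_left)).resolve_left fun h => hloc ⟨u, h⟩
  -- components of `G_uv` lie in `G_u^[1]`
  have hcompball : ∀ u v, Δ.Adj u v → ∀ L, Comp L (vstab G u ⊓ vstab G v) →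
      L ≤ ball Δ G u 1 := by
    intro u v huv L hL
    rcases comp_dichotomy hL _ (ball_normal2 hconn hG huv) with h | h
    · exact h
    · intro l hl
      have hl1 := subn_le hL.1 hl
      rw [Subgroup.commutator_eq_bot_iff_le_centralizer] at h
      have hll : l ∈ locCent Δ G u := ⟨hl1.1, h hl⟩
      have := hlocs u l hll ⟨v, huv, (mem_vstab.1 hl1.2).2⟩
      exact (mem_ball_one hconn).2 ⟨(mem_vstab.1 hl1.1).1, (mem_vstab.1 hl1.1).2, this⟩
  have hcompconj : ∀ u v, Δ.Adj u v → ∀ g ∈ vstab G u,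
      ∀ s ∈ {s | ∃ L, Comp L (vstab G u ⊓ vstab G v) ∧ s ∈ L},
        g * s * g⁻¹ ∈ {s | ∃ L, Comp L (vstab G u ⊓ vstab G v) ∧ s ∈ L} := by
    rintro u v huv g hg s ⟨L, hL, hs⟩
    have h1 : Comp L (ball Δ G u 1) :=
      ⟨subn_inf _ hL.1 (hcompball u v huv L hL) (ball_le hconn huv), hL.2⟩
    have h2 := comp_map g h1
    rw [map_conj_normal (ball_normal hconn hG u) hg] at h2
    exact ⟨_, ⟨h2.1.tail (ball_normal2 hconn hG huv), h2.2⟩, s, hs, rfl⟩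
  have hnocomp : ∀ L, ¬ Comp L (vstab G x ⊓ vstab G y) := by
    intro L hL
    refine hL.2.2.1 ?_
    rw [eq_bot_iff]
    intro l hl
    refine key hconn hG hxy _ _ le_rfl le_rfl (hsp x).1 (hsp y).1
      {s | ∃ L, Comp L (vstab G x ⊓ vstab G y) ∧ s ∈ L} ?_ ?_ (hcompconj x y hxy) ?_ l
      ⟨L, hL, hl⟩
    · rintro s ⟨L, hL, hs⟩
      exact (mem_vstab.1 (subn_le hL.1 hs).1).2
    · rintro s ⟨L, hL, hs⟩
      exact (mem_vstab.1 (subn_le hL.1 hs).2).2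
    · have := hcompconj y x hxy.symm
      rwa [inf_comm] at this
  have hlayer : layer (vstab G x ⊓ vstab G y) = ⊥ := by
    rw [layer, sSup_eq_bot]
    rintro L ⟨h1, h2⟩
    exact absurd ⟨subnormalIn_iff.1 h1, qs_iff.1 h2⟩ (hnocomp L)
  -- the prime part
  have hEpF : ∀ p : ℕ, ∀ g ∈ G, ∀ u, ∀ h ∈ Ep Δ G p u, g * h * g⁻¹ ∈ Ep Δ G p (g u) :=
    fun p g hg u h hh => Ep_conj p hG hg u hh
  have hprime : ∀ p : ℕ, p.Prime → Op p (vstab G x ⊓ vstab G y) ≠ ⊥ →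
      IsPGroup p ↥(ball Δ G x 1 ⊓ ball Δ G y 1) := by
    intro p hp hne
    by_cases hE : ∃ u, transOn Δ (Ep Δ G p u) u
    · obtain ⟨u, hu⟩ := hE
      have ht := trans_conj hG _ (hEpF p) hvt hu
      apply isPGroup_of_no_coprime hp
      intro k hk hm
      have hKn : ∀ u v, Δ.Adj u v →
          normalIn (ball Δ G u 1 ⊓ ball Δ G v 1) (ball Δ G u 1) := by
        intro u v huv
        refine ⟨inf_le_left, fun g hg k hk => ⟨?_, ?_⟩⟩
        · exact Subgroup.mul_mem _ (Subgroup.mul_mem _ hg hk.1) (Subgroup.inv_mem _ hg)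
        · exact (ball_normal hconn hG v).2 g (ball_le hconn huv hg).2 k hk.2
      refine key hconn hG hxy _ _ (Ep_le p x) (Ep_le p y) (ht x) (ht y)
        {k | k ∈ ball Δ G x 1 ⊓ ball Δ G y 1 ∧ ∃ m : ℕ, m.Coprime p ∧ k ^ m = 1}
        (fun s hs => hKx s hs.1) (fun s hs => hKy s hs.1)
        (Ep_preserves hconn hG (hKn x y hxy)) ?_ k ⟨hk, hm⟩
      have := hKn y x hxy.symm
      rw [inf_comm] at this
      exact Ep_preserves hconn hG this
    · exfalso
      have hEs : ∀ u, semiregOn Δ (Ep Δ G p u) u := fun u =>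
        ((hsp u).2 _ (normalIn_of_equiv _ (hEpF p) (Ep_le p u))).resolve_left
          fun h => hE ⟨u, h⟩
      have hinv : ∀ u v, Δ.Adj u v → ∀ g ∈ vstab G u,
          ∀ s ∈ (Op p (vstab G u ⊓ vstab G v) : Set (Equiv.Perm V)),
            g * s * g⁻¹ ∈ (Op p (vstab G u ⊓ vstab G v) : Set (Equiv.Perm V)) := by
        intro u v huv g hg s hs
        obtain ⟨hRn, hRp⟩ := Op_spec p (vstab G u ⊓ vstab G v)
        have hle : Op p (vstab G u ⊓ vstab G v) ≤ ball Δ G u 1 := by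
          intro r hr
          have hrH := hRn.1 hr
          have hrE : r ∈ Ep Δ G p u :=
            (le_iSup₂_of_le v huv le_rfl :
              Op p (vstab G u ⊓ vstab G v) ≤ Ep Δ G p u) hr
          have := hEs u r hrE ⟨v, huv, (mem_vstab.1 hrH.2).2⟩
          exact (mem_ball_one hconn).2 ⟨(mem_vstab.1 hrH.1).1, (mem_vstab.1 hrH.1).2, this⟩
        have hRb : normalIn (Op p (vstab G u ⊓ vstab G v)) (ball Δ G u 1) :=
          ⟨hle, fun h hh => hRn.2 h (ball_le hconn huv hh)⟩
        have hs' : s ∈ Op p (ball Δ G u 1) := le_Op hRb hRp hs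
        exact Op_mono (ball_normal2 hconn hG huv)
          ((Op_normal (ball_normal hconn hG u)).2 g hg s hs')
      apply hne
      rw [eq_bot_iff]
      intro r hr
      have hRle := (Op_spec p (vstab G x ⊓ vstab G y)).1.1
      refine key hconn hG hxy _ _ le_rfl le_rfl (hsp x).1 (hsp y).1
        (Op p (vstab G x ⊓ vstab G y) : Set (Equiv.Perm V))
        (fun s hs => (mem_vstab.1 (hRle hs).1).2) (fun s hs => (mem_vstab.1 (hRle hs).2).2)
        (hinv x y hxy) ?_ r hr
      have := hinv y x hxy.symm
      rwa [inf_comm] at this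
  by_cases hall : ∀ p : ℕ, p.Prime → Op p (vstab G x ⊓ vstab G y) = ⊥
  · have hH := eq_bot_of hnocomp hall
    apply htriv
    rw [eq_bot_iff, ← hH]
    exact inf_le_left.trans (ball_le hconn hxy)
  push Not at hall
  obtain ⟨p, hp, hne⟩ := hall
  by_cases hq : ∃ q : ℕ, q.Prime ∧ q ≠ p ∧ Op q (vstab G x ⊓ vstab G y) ≠ ⊥
  · obtain ⟨q, hq, hqp, hqne⟩ := hq
    apply htriv
    have : Fact p.Prime := ⟨hp⟩
    have : Fact q.Prime := ⟨hq⟩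
    have := IsPGroup.disjoint_of_ne p q hqp.symm _ _ (hprime p hp hne) (hprime q hq hqne)
    exact disjoint_self.1 this
  · push Not at hq
    refine ⟨⟨p, hp, hprime p hp hne⟩, Or.inl ⟨p, hp, ?_⟩⟩
    have hle : genFitting (vstab G x ⊓ vstab G y) ≤ Op p (vstab G x ⊓ vstab G y) := by
      rw [genFitting, hlayer, bot_sup_eq]
      exact fitting_le hp hq
    exact (Op_spec p _).2.to_le hle
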